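/- Let x ≥ 2 and σ < 1 be real numbers. Then | ∫₂ˣ u^{−σ}/(2·log x − log u) du − x^{1−σ}/((1−σ)·log x) | ≤ ( 1 + ((1−σ)·(log x)²/(2·log x − log 2))·(2/x)^{1−σ} )·x^{1−σ}/((1−σ)²·(log x)²). -/

import Mathlib

/-- The derivative behind the integration by parts of `u ^ (-σ) / (c - log u)`. -/
lemma hasDerivAt_rpow_div_log_sub {c σ u : ℝ} (hσ : σ < 1) (hu : 0 < u)
    (hc : c - Real.log u ≠ 0) :
    HasDerivAt (fun v => v ^ (1 - σ) / ((1 - σ) * (c - Real.log v)))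
      (u ^ (-σ) / (c - Real.log u) + u ^ (-σ) / ((1 - σ) * (c - Real.log u) ^ 2)) u := by
  have ha : 1 - σ ≠ 0 := by linarith
  have hpow : HasDerivAt (fun v : ℝ => v ^ (1 - σ)) ((1 - σ) * u ^ (1 - σ - 1)) u :=
    Real.hasDerivAt_rpow_const (Or.inl hu.ne')
  have hden : HasDerivAt (fun v : ℝ => (1 - σ) * (c - Real.log v)) ((1 - σ) * (-u⁻¹)) u :=
    ((Real.hasDerivAt_log hu.ne').const_sub c).const_mul (1 - σ)
  refine (hpow.div hden (mul_ne_zero ha hc)).congr_deriv ?_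
  have hsplit : u ^ (1 - σ) = u * u ^ (-σ) := by
    rw [sub_eq_add_neg, Real.rpow_add hu, Real.rpow_one]
  rw [hsplit, show 1 - σ - 1 = -σ by ring]
  field_simp
  ring

/-- Estimate for `∫₂ˣ u^{−σ}/(2 log x − log u) du`. -/
theorem integral_estimate (x σ : ℝ) (hx : 2 ≤ x) (hσ : σ < 1) :
    |(∫ u in (2 : ℝ)..x, u ^ (-σ) / (2 * Real.log x - Real.log u)) -
        x ^ (1 - σ) / ((1 - σ) * Real.log x)| ≤
      (1 + (1 - σ) * Real.log x ^ 2 / (2 * Real.log x - Real.log 2) * (2 / x) ^ (1 - σ)) *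
        x ^ (1 - σ) / ((1 - σ) ^ 2 * Real.log x ^ 2) := by
  have ha : 0 < 1 - σ := by linarith
  have hx0 : 0 < x := by linarith
  have hL : 0 < Real.log x := Real.log_pos (by linarith)
  have hlog : ∀ u ∈ Set.Icc 2 x, Real.log x ≤ 2 * Real.log x - Real.log u := by
    intro u hu
    have := Real.log_le_log (by linarith [hu.1]) hu.2
    linarith
  have hL2 : 0 < 2 * Real.log x - Real.log 2 := hL.trans_le (hlog 2 ⟨le_rfl, hx⟩)
  have hne : ∀ u ∈ Set.uIcc 2 x, 0 < u ∧ 2 * Real.log x - Real.log u ≠ 0 := by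
    intro u hu
    rw [Set.uIcc_of_le hx] at hu
    exact ⟨by linarith [hu.1], (hL.trans_le (hlog u hu)).ne'⟩
  have hcpow : ContinuousOn (fun u : ℝ => u ^ (-σ)) (Set.uIcc 2 x) :=
    continuousOn_id.rpow_const fun u hu => Or.inl (hne u hu).1.ne'
  have hclog : ContinuousOn (fun u : ℝ => 2 * Real.log x - Real.log u) (Set.uIcc 2 x) :=
    continuousOn_const.sub (continuousOn_id.log fun u hu => (hne u hu).1.ne')
  have hf : IntervalIntegrable (fun u : ℝ => u ^ (-σ) / (2 * Real.log x - Real.log u))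
      MeasureTheory.volume 2 x :=
    (hcpow.div hclog fun u hu => (hne u hu).2).intervalIntegrable
  have hg : IntervalIntegrable
      (fun u : ℝ => u ^ (-σ) / ((1 - σ) * (2 * Real.log x - Real.log u) ^ 2))
      MeasureTheory.volume 2 x :=
    (hcpow.div (continuousOn_const.mul (hclog.pow 2)) fun u hu =>
      mul_ne_zero ha.ne' (pow_ne_zero 2 (hne u hu).2)).intervalIntegrable
  have hparts := intervalIntegral.integral_eq_sub_of_hasDerivAt
    (fun u hu => hasDerivAt_rpow_div_log_sub hσ (hne u hu).1 (hne u hu).2) (hf.add hg)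
  rw [intervalIntegral.integral_add hf hg,
    show 2 * Real.log x - Real.log x = Real.log x by ring] at hparts
  have hnonneg : 0 ≤ ∫ u in (2 : ℝ)..x,
      u ^ (-σ) / ((1 - σ) * (2 * Real.log x - Real.log u) ^ 2) := by
    refine intervalIntegral.integral_nonneg hx fun u hu => ?_
    have : 0 ≤ u := by linarith [hu.1]
    positivity
  have hle : ∫ u in (2 : ℝ)..x, u ^ (-σ) / ((1 - σ) * (2 * Real.log x - Real.log u) ^ 2) ≤
      ∫ u in (2 : ℝ)..x, u ^ (-σ) / ((1 - σ) * Real.log x ^ 2) := by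
    refine intervalIntegral.integral_mono_on hx hg (hcpow.div_const _).intervalIntegrable
      fun u hu => ?_
    have : 0 ≤ u := by linarith [hu.1]
    have := hlog u hu
    gcongr
  rw [intervalIntegral.integral_div, integral_rpow (Or.inl (by linarith)),
    show -σ + 1 = 1 - σ by ring] at hle
  have hrhs : (1 + (1 - σ) * Real.log x ^ 2 / (2 * Real.log x - Real.log 2) *
        (2 / x) ^ (1 - σ)) * x ^ (1 - σ) / ((1 - σ) ^ 2 * Real.log x ^ 2) =
      x ^ (1 - σ) / (1 - σ) / ((1 - σ) * Real.log x ^ 2) +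
        2 ^ (1 - σ) / ((1 - σ) * (2 * Real.log x - Real.log 2)) := by
    rw [Real.div_rpow zero_le_two hx0.le]
    have := (Real.rpow_pos_of_pos hx0 (1 - σ)).ne'
    field_simp
  have htwo : 0 ≤ (2 : ℝ) ^ (1 - σ) / ((1 - σ) * (2 * Real.log x - Real.log 2)) := by
    positivity
  have hdrop : (x ^ (1 - σ) - 2 ^ (1 - σ)) / (1 - σ) / ((1 - σ) * Real.log x ^ 2) ≤
      x ^ (1 - σ) / (1 - σ) / ((1 - σ) * Real.log x ^ 2) := by
    gcongr
    exact sub_le_self _ (by positivity)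
  rw [hrhs, abs_le]
  constructor <;> linarith
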